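/- arXiv:2006.09018 — 3 statements merged into one kernel-verified Lean document; each statement's English description precedes it below -/
import Mathlib

section
/- The cyclically presented group G_8(x_0 x_1 x_5) contains a free abelian subgroup of rank 2; that is, there exists an injective group homomorphism from ℤ × ℤ into G_8(x_0 x_1 x_5). -/
/-- Relators `x_i x_{i+a} x_{i+b}` of the cyclic presentation `P_n(x_0 x_a x_b)`. -/
def posRels (n : ℕ) (a b : ZMod n) : Set (FreeGroup (ZMod n)) :=
  Set.range fun i : ZMod n => FreeGroup.of i * FreeGroup.of (i + a) * FreeGroup.of (i + b)

/-- The cyclically presented group `G_n(x_0 x_a x_b)`. -/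
abbrev Gpos (n : ℕ) (a b : ZMod n) : Type := PresentedGroup (posRels n a b)

/-- Relators `x_i x_{i+a} x_{i+b}⁻¹` of the cyclic presentation `P_n(x_0 x_a x_b⁻¹)`. -/
def negRels (n : ℕ) (a b : ZMod n) : Set (FreeGroup (ZMod n)) :=
  Set.range fun i : ZMod n => FreeGroup.of i * FreeGroup.of (i + a) * (FreeGroup.of (i + b))⁻¹

/-- The cyclically presented group `G_n(x_0 x_a x_b⁻¹)`. -/
abbrev Gneg (n : ℕ) (a b : ZMod n) : Type := PresentedGroup (negRels n a b)

namespace G8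

noncomputable def T (a b c d : ℂ) : Matrix (Fin 3) (Fin 3) ℂ := !![1, a, b; 0, c, d; 0, 0, 1]

/-- The fifteenth cyclotomic polynomial. -/
noncomputable def Phi (z : ℂ) : ℂ := z^8 - z^7 + z^5 - z^4 + z^3 - z + 1

lemma T_mul (a b c d a' b' c' d' : ℂ) :
    T a b c d * T a' b' c' d' = T (a' + a * c') (b' + a * d' + b) (c * c') (c * d' + d) := by
  ext i j
  fin_cases i <;> fin_cases j <;> simp [T, Matrix.mul_apply, Fin.sum_univ_three]

lemma T_mul_eq {a b c d a' b' c' d' a2 b2 c2 d2 : ℂ} (h1 : a' + a * c' = a2)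
    (h2 : b' + a * d' + b = b2) (h3 : c * c' = c2) (h4 : c * d' + d = d2) :
    T a b c d * T a' b' c' d' = T a2 b2 c2 d2 := by
  rw [T_mul, h1, h2, h3, h4]

lemma T_one : T 0 0 1 0 = 1 := by
  ext i j
  fin_cases i <;> fin_cases j <;> simp [T]

lemma exists_root : ∃ z : ℂ, Phi z = 0 := by
  have h := Complex.isPrimitiveRoot_exp 15 (by norm_num)
  set z := Complex.exp (2 * Real.pi * Complex.I / (15 : ℕ)) with hzdef
  refine ⟨z, ?_⟩
  have h15 : z ^ 15 = 1 := h.pow_eq_one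
  have h5 : z ^ 5 - 1 ≠ 0 := sub_ne_zero.mpr (h.pow_ne_one_of_pos_of_lt (by norm_num) (by norm_num))
  have h3 : z ^ 3 - 1 ≠ 0 := sub_ne_zero.mpr (h.pow_ne_one_of_pos_of_lt (by norm_num) (by norm_num))
  have key : (z ^ 5 - 1) * ((z ^ 3 - 1) * Phi z) = 0 := by
    unfold Phi
    linear_combination (z - 1) * h15
  rcases mul_eq_zero.mp key with h | h
  · exact absurd h h5
  · exact (mul_eq_zero.mp h).resolve_left h3

noncomputable def M0 (z : ℂ) : Matrix (Fin 3) (Fin 3) ℂ :=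
  T (-15*z - 15*z^4 - 15*z^6)
    (18 + 9*z + 16*z^2 + 15*z^3 + 9*z^4 + 7*z^5 + 8*z^6 + z^7)
    (z)
    (z^2 + z^5 + z^7)

noncomputable def M1 (z : ℂ) : Matrix (Fin 3) (Fin 3) ℂ :=
  T (-15*z^3 + 15*z^7)
    (21 + 3*z - 8*z^2 - 12*z^4 + 4*z^5 + 11*z^6 - 8*z^7)
    (z^7)
    (1 - z^4)

noncomputable def M2 (z : ℂ) : Matrix (Fin 3) (Fin 3) ℂ :=
  T (15*z + 15*z^6 + 15*z^7)
    (12 + 6*z + 4*z^2 - 9*z^4 - 2*z^5 + 2*z^6 + 4*z^7)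
    (z^4)
    (1 - z - z^2 + z^3 - z^4 + z^5 - 2*z^7)

noncomputable def M3 (z : ℂ) : Matrix (Fin 3) (Fin 3) ℂ :=
  T (-15*z^5)
    (9 - 3*z - 2*z^2 - 3*z^4 + z^5 - z^6 - 2*z^7)
    (1 - z - z^4 + z^5 - z^7)
    (1 - z + z^3 - z^4 + z^5 - z^7)

noncomputable def M4 (z : ℂ) : Matrix (Fin 3) (Fin 3) ℂ :=
  T (15 + 15*z^3 + 15*z^5 + 15*z^6)
    (33 - 6*z - 14*z^2 + 15*z^3 - 21*z^4 + 7*z^5 + 8*z^6 - 29*z^7)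
    (z)
    (-z - z^4 - z^6 - z^7)

noncomputable def M5 (z : ℂ) : Matrix (Fin 3) (Fin 3) ℂ :=
  T (-15 + 15*z^2 + 15*z^4 - 15*z^6 + 15*z^7)
    (21 + 3*z - 8*z^2 - 12*z^4 + 4*z^5 + 11*z^6 - 8*z^7)
    (z^7)
    (1 - z + z^3 + z^5 - z^7)

noncomputable def M6 (z : ℂ) : Matrix (Fin 3) (Fin 3) ℂ :=
  T (0)
    (-3 + 6*z + 4*z^2 + 6*z^4 - 2*z^5 + 2*z^6 + 4*z^7)
    (z^4)
    (0)

noncomputable def M7 (z : ℂ) : Matrix (Fin 3) (Fin 3) ℂ :=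
  T (15*z^7)
    (9 - 3*z - 2*z^2 - 3*z^4 + z^5 - z^6 - 2*z^7)
    (1 - z - z^4 + z^5 - z^7)
    (z^6)

noncomputable def One (_z : ℂ) : Matrix (Fin 3) (Fin 3) ℂ := T 0 0 1 0

noncomputable def N0 (z : ℂ) : Matrix (Fin 3) (Fin 3) ℂ :=
  T (15 + 15*z^3 + 15*z^5)
    (27 - 24*z - 16*z^2 - 24*z^4 + 8*z^5 - 8*z^6 - 31*z^7)
    (1 - z^2 + z^3 - z^4 + z^6 - z^7)
    (-z - z^4 - z^6)

lemma pairs0 (z : ℂ) (hz : Phi z = 0) : M1 z * M5 z = N0 z := by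
  unfold Phi at hz
  apply T_mul_eq
  · linear_combination (-30 - 30*z - 15*z^2 + 15*z^4 + 15*z^5 + 15*z^6) * hz
  · linear_combination (15 + 45*z + 45*z^2 + 15*z^3 - 15*z^5 - 15*z^6) * hz
  · linear_combination (-1 - z + z^4 + z^5 + z^6) * hz
  · linear_combination (1 + 2*z + 2*z^2 + z^3 - z^5 - z^6) * hz

lemma triple0 (z : ℂ) (hz : Phi z = 0) : M0 z * N0 z = One z := by
  unfold Phi at hz
  apply T_mul_eq
  · linear_combination (15 + 15*z^3 + 15*z^5) * hz
  · linear_combination (45 + 30*z + 45*z^2 + 15*z^3 + 15*z^4) * hz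
  · linear_combination (-1) * hz
  · linear_combination (0) * hz

noncomputable def N1 (z : ℂ) : Matrix (Fin 3) (Fin 3) ℂ :=
  T (-15 - 15*z - 15*z^6)
    (9 + 12*z + 8*z^2 - 3*z^4 - 4*z^5 + 4*z^6 + 8*z^7)
    (-1 + z - z^3 + z^4 - z^5 + z^7)
    (1 - z - z^2 + z^3 - z^4 + z^5 - 2*z^7)

lemma pairs1 (z : ℂ) (hz : Phi z = 0) : M2 z * M6 z = N1 z := by
  unfold Phi at hz
  apply T_mul_eq
  · linear_combination (15 + 30*z + 30*z^2 + 15*z^3) * hz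
  · linear_combination (0) * hz
  · linear_combination (1) * hz
  · linear_combination (0) * hz

lemma triple1 (z : ℂ) (hz : Phi z = 0) : M1 z * N1 z = One z := by
  unfold Phi at hz
  apply T_mul_eq
  · linear_combination (-15 - 30*z - 30*z^2 + 15*z^5 + 15*z^6) * hz
  · linear_combination (30 + 45*z + 45*z^2 - 15*z^4 - 30*z^5 - 30*z^6) * hz
  · linear_combination (-1 - z - z^2 + z^5 + z^6) * hz
  · linear_combination (1 + z + z^2 - z^4 - 2*z^5 - 2*z^6) * hz

noncomputable def N2 (z : ℂ) : Matrix (Fin 3) (Fin 3) ℂ :=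
  T (-15*z^3 + 15*z^7)
    (18 + 9*z - 4*z^2 - 6*z^4 + 2*z^5 + 13*z^6 - 4*z^7)
    (-z - z^6)
    (1 - z + z^3 + z^5 - z^7)

lemma pairs2 (z : ℂ) (hz : Phi z = 0) : M3 z * M7 z = N2 z := by
  unfold Phi at hz
  apply T_mul_eq
  · linear_combination (15*z^3 + 15*z^4) * hz
  · linear_combination (-15*z - 15*z^2 - 15*z^3) * hz
  · linear_combination (1 + z^2 - z^4 + z^5 + z^6) * hz
  · linear_combination (-z^4 - z^5) * hz

lemma triple2 (z : ℂ) (hz : Phi z = 0) : M2 z * N2 z = One z := by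
  unfold Phi at hz
  apply T_mul_eq
  · linear_combination (-15*z^2 - 30*z^3 - 30*z^4 - 15*z^5) * hz
  · linear_combination (30 + 60*z + 45*z^2 + 15*z^3 - 15*z^4 - 30*z^5 - 15*z^6) * hz
  · linear_combination (-1 - z - z^2) * hz
  · linear_combination (1 - z^2 - z^3) * hz

noncomputable def N3 (z : ℂ) : Matrix (Fin 3) (Fin 3) ℂ :=
  T (15*z^7)
    (6 + 3*z + 2*z^2 + 3*z^4 - z^5 + z^6 + 2*z^7)
    (z^2)
    (-1 - z^5)

lemma pairs3 (z : ℂ) (hz : Phi z = 0) : M4 z * M0 z = N3 z := by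
  unfold Phi at hz
  apply T_mul_eq
  · linear_combination (0) * hz
  · linear_combination (45 + 45*z + 60*z^2 + 45*z^3 + 30*z^4 + 15*z^5) * hz
  · linear_combination (0) * hz
  · linear_combination (1) * hz

lemma triple3 (z : ℂ) (hz : Phi z = 0) : M3 z * N3 z = One z := by
  unfold Phi at hz
  apply T_mul_eq
  · linear_combination (0) * hz
  · linear_combination (15 + 15*z + 15*z^2) * hz
  · linear_combination (-1 - z) * hz
  · linear_combination (z^3 + z^4) * hz

noncomputable def N4 (z : ℂ) : Matrix (Fin 3) (Fin 3) ℂ :=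
  T (-15 - 15*z^3 - 15*z^5 - 15*z^6 + 15*z^7)
    (27 + 6*z - z^2 + 15*z^3 - 9*z^4 + 8*z^5 + 7*z^6 - 16*z^7)
    (1 - z^2 + z^3 - z^4 + z^6 - z^7)
    (1 + z^3 + z^5 + z^6)

lemma pairs4 (z : ℂ) (hz : Phi z = 0) : M5 z * M1 z = N4 z := by
  unfold Phi at hz
  apply T_mul_eq
  · linear_combination (15 + 15*z + 15*z^2 + 15*z^6) * hz
  · linear_combination (-15*z^3) * hz
  · linear_combination (-1 - z + z^4 + z^5 + z^6) * hz
  · linear_combination (-z - z^2 - z^3) * hz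

lemma triple4 (z : ℂ) (hz : Phi z = 0) : M4 z * N4 z = One z := by
  unfold Phi at hz
  apply T_mul_eq
  · linear_combination (-15*z^2 - 15*z^4 - 15*z^5) * hz
  · linear_combination (75 + 75*z + 60*z^2 + 45*z^3 + 15*z^4) * hz
  · linear_combination (-1) * hz
  · linear_combination (0) * hz

noncomputable def N5 (z : ℂ) : Matrix (Fin 3) (Fin 3) ℂ :=
  T (15*z + 15*z^6 + 15*z^7)
    (9 + 12*z + 8*z^2 - 3*z^4 - 4*z^5 + 4*z^6 + 8*z^7)
    (-1 + z - z^3 + z^4 - z^5 + z^7)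
    (z + z^2 + z^7)

lemma pairs5 (z : ℂ) (hz : Phi z = 0) : M6 z * M2 z = N5 z := by
  unfold Phi at hz
  apply T_mul_eq
  · linear_combination (0) * hz
  · linear_combination (0) * hz
  · linear_combination (1) * hz
  · linear_combination (-z - 2*z^2 - 2*z^3) * hz

lemma triple5 (z : ℂ) (hz : Phi z = 0) : M5 z * N5 z = One z := by
  unfold Phi at hz
  apply T_mul_eq
  · linear_combination (15 + 15*z + 15*z^3 - 15*z^4 + 15*z^6) * hz
  · linear_combination (30 + 30*z + 15*z^2 + 15*z^6) * hz
  · linear_combination (-1 - z - z^2 + z^5 + z^6) * hz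
  · linear_combination (1 + z^4 + z^5 + z^6) * hz

noncomputable def N6 (z : ℂ) : Matrix (Fin 3) (Fin 3) ℂ :=
  T (0)
    (3 - 6*z - 4*z^2 - 6*z^4 + 2*z^5 - 2*z^6 - 4*z^7)
    (-z - z^6)
    (0)

lemma pairs6 (z : ℂ) (hz : Phi z = 0) : M7 z * M3 z = N6 z := by
  unfold Phi at hz
  apply T_mul_eq
  · linear_combination (-15*z^5 - 15*z^6) * hz
  · linear_combination (15 + 15*z + 15*z^2 - 15*z^5 - 15*z^6) * hz
  · linear_combination (1 + z^2 - z^4 + z^5 + z^6) * hz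
  · linear_combination (1 - z - z^4 + z^5 + z^6) * hz

lemma triple6 (z : ℂ) (hz : Phi z = 0) : M6 z * N6 z = One z := by
  unfold Phi at hz
  apply T_mul_eq
  · linear_combination (0) * hz
  · linear_combination (0) * hz
  · linear_combination (-1 - z - z^2) * hz
  · linear_combination (0) * hz

noncomputable def N7 (z : ℂ) : Matrix (Fin 3) (Fin 3) ℂ :=
  T (15 - 15*z^2 + 15*z^3 + 15*z^6 - 15*z^7)
    (6 + 3*z + 2*z^2 + 3*z^4 - z^5 + z^6 + 2*z^7)
    (z^2)
    (1 - z + z^3 - z^4 + z^5 - z^7)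

lemma pairs7 (z : ℂ) (hz : Phi z = 0) : M0 z * M4 z = N7 z := by
  unfold Phi at hz
  apply T_mul_eq
  · linear_combination (0) * hz
  · linear_combination (45 + 45*z + 60*z^2 + 45*z^3 + 30*z^4 + 15*z^5) * hz
  · linear_combination (0) * hz
  · linear_combination (-1) * hz

lemma triple7 (z : ℂ) (hz : Phi z = 0) : M7 z * N7 z = One z := by
  unfold Phi at hz
  apply T_mul_eq
  · linear_combination (15 + 15*z) * hz
  · linear_combination (15 + 15*z + 15*z^2 - 15*z^5 - 15*z^6) * hz
  · linear_combination (-1 - z) * hz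
  · linear_combination (1 - z - z^4 + z^5 + z^6) * hz

noncomputable def U (z : ℂ) : Matrix (Fin 3) (Fin 3) ℂ :=
  T (30 + 15*z^3 - 15*z^4 + 15*z^5 + 15*z^6)
    (15 + 15*z + 5*z^2 - 10*z^5 + 10*z^6 + 5*z^7)
    (z^5)
    (2 - z + z^3 - z^4 + 2*z^5 + z^6 - z^7)

lemma u1 (z : ℂ) (hz : Phi z = 0) : M0 z * M2 z = U z := by
  unfold Phi at hz
  apply T_mul_eq
  · linear_combination (-30 - 15*z - 15*z^2) * hz
  · linear_combination (15 + 30*z^2 + 45*z^3 + 30*z^4 + 30*z^5) * hz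
  · linear_combination (0) * hz
  · linear_combination (-2) * hz

noncomputable def U2 (z : ℂ) : Matrix (Fin 3) (Fin 3) ℂ :=
  T (15 - 15*z^2 + 15*z^3 + 15*z^5 + 15*z^6)
    (45 + 15*z - 5*z^2 + 15*z^3 + 25*z^5 + 35*z^6 - 5*z^7)
    (-1 - z^5)
    (-z + z^3 + z^5)

lemma u2 (z : ℂ) (hz : Phi z = 0) : U z * U z = U2 z := by
  unfold Phi at hz
  apply T_mul_eq
  · linear_combination (15 + 15*z + 30*z^2 + 15*z^3) * hz
  · linear_combination (45 + 30*z + 45*z^2 + 45*z^3 - 15*z^4 - 15*z^5) * hz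
  · linear_combination (1 + z + z^2) * hz
  · linear_combination (2 + 2*z + 2*z^2 - z^4) * hz

noncomputable def U3 (z : ℂ) : Matrix (Fin 3) (Fin 3) ℂ :=
  T (0)
    (15 + 15*z + 15*z^3 + 15*z^4 + 15*z^5 + 30*z^6)
    (1)
    (0)

lemma u3 (z : ℂ) (hz : Phi z = 0) : U2 z * U z = U3 z := by
  unfold Phi at hz
  apply T_mul_eq
  · linear_combination (30 + 30*z + 30*z^2 + 15*z^3) * hz
  · linear_combination (75 + 75*z + 45*z^2 + 30*z^3 - 15*z^4 - 15*z^5) * hz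
  · linear_combination (-1 - z - z^2) * hz
  · linear_combination (-2 - 2*z - 2*z^2 + z^4) * hz

noncomputable def H1 (z : ℂ) : Matrix (Fin 3) (Fin 3) ℂ :=
  T (-15 + 15*z^7)
    (21 + 3*z + 12*z^2 + 15*z^3 + 3*z^4 + 9*z^5 + 6*z^6 - 3*z^7)
    (-z^2 - z^7)
    (z^2 + z^5 + z^7)

lemma h1 (z : ℂ) (hz : Phi z = 0) : U z * M5 z = H1 z := by
  unfold Phi at hz
  apply T_mul_eq
  · linear_combination (15*z^2 + 15*z^3 + 30*z^4 + 15*z^5) * hz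
  · linear_combination (45 + 30*z + 15*z^2 - 30*z^4 - 15*z^5) * hz
  · linear_combination (z^2 + z^3 + z^4) * hz
  · linear_combination (2 + z - z^3 - z^4) * hz

noncomputable def H2 (z : ℂ) : Matrix (Fin 3) (Fin 3) ℂ :=
  T (-15 + 15*z + 15*z^4 - 15*z^5 + 15*z^7)
    (15*z + 10*z^2 + 15*z^4 - 5*z^5 + 5*z^6 + 10*z^7)
    (-1 - z^5)
    (z^2 + z^7)

lemma h2 (z : ℂ) (hz : Phi z = 0) : H1 z * M3 z = H2 z := by
  unfold Phi at hz
  apply T_mul_eq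
  · linear_combination (-15*z^5 - 15*z^6) * hz
  · linear_combination (15 + 15*z + 15*z^2 - 15*z^5 - 15*z^6) * hz
  · linear_combination (1 + z + z^5 + z^6) * hz
  · linear_combination (-z^2 + z^5 + z^6) * hz

noncomputable def H3 (z : ℂ) : Matrix (Fin 3) (Fin 3) ℂ :=
  T (-15*z^3 - 15*z^5 + 15*z^7)
    (6 + 33*z + 17*z^2 + 18*z^4 - 16*z^5 + 16*z^6 + 17*z^7)
    (z^2)
    (-2 + 2*z^2 - z^3 + z^4 - z^5 - z^6 + 2*z^7)

lemma h3 (z : ℂ) (hz : Phi z = 0) : H2 z * M1 z = H3 z := by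
  unfold Phi at hz
  apply T_mul_eq
  · linear_combination (15*z^5 + 15*z^6) * hz
  · linear_combination (-15*z^2 - 15*z^3) * hz
  · linear_combination (-z^2 - z^3 - z^4) * hz
  · linear_combination (1 + z) * hz

noncomputable def H4 (z : ℂ) : Matrix (Fin 3) (Fin 3) ℂ :=
  T (-15*z - 15*z^3 + 15*z^5 + 15*z^7)
    (45 + 30*z + 15*z^3 + 45*z^6 - 15*z^7)
    (1)
    (-3 + z + 2*z^2 - 2*z^3 + 2*z^4 - 2*z^5 - z^6 + 3*z^7)

lemma h4 (z : ℂ) (hz : Phi z = 0) : H3 z * M7 z = H4 z := by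
  unfold Phi at hz
  apply T_mul_eq
  · linear_combination (15*z + 15*z^2 + 15*z^3 + 15*z^4 - 15*z^5 - 15*z^6) * hz
  · linear_combination (-30 - 30*z - 15*z^2 + 15*z^4 + 15*z^5) * hz
  · linear_combination (-1 - z) * hz
  · linear_combination (1) * hz

lemma beta_ne (z : ℂ) (hz : Phi z = 0) : 15 + 15*z + 15*z^3 + 15*z^4 + 15*z^5 + 30*z^6 ≠ 0 := by
  unfold Phi at hz
  intro h
  have : (15 : ℂ) = 0 := by
    linear_combination (1 - 2*z + 3*z^3 - 2*z^4 - z^5 + z^6) * h - (-15*z - 45*z^2 + 15*z^3 + 30*z^4) * hz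
  norm_num at this

lemma alpha_ne (z : ℂ) (hz : Phi z = 0) : -15*z - 15*z^3 + 15*z^5 + 15*z^7 ≠ 0 := by
  unfold Phi at hz
  intro h
  have : (15 : ℂ) = 0 := by
    linear_combination (1 - 3*z + z^2 + 4*z^3 - 4*z^4 - z^5 + 3*z^6 - z^7) * h - (-15 - 30*z + 15*z^2 + 30*z^5 - 15*z^6) * hz
  norm_num at this

noncomputable def mat (z : ℂ) : ZMod 8 → Matrix (Fin 3) (Fin 3) ℂ :=
  fun i => (![M0 z, M1 z, M2 z, M3 z, M4 z, M5 z, M6 z, M7 z] : Fin 8 → _) i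

lemma mat_rel (z : ℂ) (hz : Phi z = 0) (i : ZMod 8) :
    mat z i * (mat z (i + 1) * mat z (i + 5)) = 1 := by
  have h : ∀ i : Fin 8, mat z i * (mat z (i + 1 : Fin 8) * mat z (i + 5 : Fin 8)) = 1 := by
    intro i
    rw [← T_one]
    fin_cases i
    · change M0 z * (M1 z * M5 z) = _
      rw [pairs0 z hz, triple0 z hz]; rfl
    · change M1 z * (M2 z * M6 z) = _
      rw [pairs1 z hz, triple1 z hz]; rfl
    · change M2 z * (M3 z * M7 z) = _
      rw [pairs2 z hz, triple2 z hz]; rfl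
    · change M3 z * (M4 z * M0 z) = _
      rw [pairs3 z hz, triple3 z hz]; rfl
    · change M4 z * (M5 z * M1 z) = _
      rw [pairs4 z hz, triple4 z hz]; rfl
    · change M5 z * (M6 z * M2 z) = _
      rw [pairs5 z hz, triple5 z hz]; rfl
    · change M6 z * (M7 z * M3 z) = _
      rw [pairs6 z hz, triple6 z hz]; rfl
    · change M7 z * (M0 z * M4 z) = _
      rw [pairs7 z hz, triple7 z hz]; rfl
  exact h i

noncomputable def unitMat (z : ℂ) (hz : Phi z = 0) (i : ZMod 8) : (Matrix (Fin 3) (Fin 3) ℂ)ˣ where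
  val := mat z i
  inv := mat z (i + 1) * mat z (i + 5)
  val_inv := mat_rel z hz i
  inv_val := mul_eq_one_comm.mp (mat_rel z hz i)

/-- The representation of the group by upper triangular matrices. -/
noncomputable def rho (z : ℂ) (hz : Phi z = 0) : Gpos 8 1 5 →* (Matrix (Fin 3) (Fin 3) ℂ)ˣ :=
  PresentedGroup.toGroup (f := unitMat z hz) (by
    rintro _ ⟨i, rfl⟩
    ext1
    simp only [map_mul, FreeGroup.lift_apply_of, Units.val_mul, Units.val_one, mul_assoc]
    exact mat_rel z hz i)

/-- The generators. -/
def x (i : ZMod 8) : Gpos 8 1 5 := PresentedGroup.of i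

lemma rho_x (z : ℂ) (hz : Phi z = 0) (i : ZMod 8) : (rho z hz (x i)).val = mat z i := by
  simp [rho, x, unitMat]

lemma x_rel (i : ZMod 8) : x i * x (i + 1) * x (i + 5) = 1 :=
  PresentedGroup.one_of_mem (rels := posRels 8 1 5) ⟨i, rfl⟩

/-- `Tri i j k`: the three generators form a relator, up to rotation. -/
def Tri (i j k : ZMod 8) : Prop :=
  (j = i + 1 ∧ k = i + 5) ∨ (k = j + 1 ∧ i = j + 5) ∨ (i = k + 1 ∧ j = k + 5)

instance (i j k : ZMod 8) : Decidable (Tri i j k) := by unfold Tri; infer_instance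

lemma x_tri {i j k : ZMod 8} (h : Tri i j k) : x i * x j * x k = 1 := by
  rcases h with ⟨rfl, rfl⟩ | ⟨rfl, rfl⟩ | ⟨rfl, rfl⟩
  · exact x_rel i
  · have := x_rel j
    rw [mul_assoc, mul_eq_one_iff_eq_inv']
    rw [mul_eq_one_iff_eq_inv'] at this
    rw [this]; simp
  · have := x_rel k
    rw [mul_assoc] at this
    rw [mul_eq_one_iff_eq_inv'] 
    rw [mul_eq_one_iff_eq_inv] at this
    exact this

lemma square {a b' b a' : ZMod 8} (h : ∃ k, Tri a b' k ∧ Tri b a' k) :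
    x a * x b' = x b * x a' := by
  obtain ⟨k, h1, h2⟩ := h
  exact mul_right_cancel ((x_tri h1).trans (x_tri h2).symm)

lemma chain {G : Type*} [Group G] {X X' b c d a a' : G} (h : X * b = c * X')
    (s : a * c = d * a') : (a * X) * b = d * (a' * X') := by
  rw [mul_assoc, h, ← mul_assoc, s, mul_assoc]

def row (a b c d e f : ZMod 8) : Gpos 8 1 5 := x a * (x b * (x c * (x d * (x e * x f))))

lemma rowstep0 : row 0 2 0 2 0 2 * x 5 = x 5 * row 1 6 6 5 2 2 := by
  have s5 : x 2 * x 5 = x 1 * x 2 := square (by decide)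
  have s4 : x 0 * x 1 = x 6 * x 2 := square (by decide)
  have s3 : x 2 * x 6 = x 4 * x 5 := square (by decide)
  have s2 : x 0 * x 4 = x 3 * x 6 := square (by decide)
  have s1 : x 2 * x 3 = x 3 * x 6 := square (by decide)
  have s0 : x 0 * x 3 = x 5 * x 1 := square (by decide)
  exact chain (chain (chain (chain (chain s5 s4) s3) s2) s1) s0

lemma rowstep1 : row 1 6 6 5 2 2 * x 3 = x 3 * row 4 6 4 6 4 6 := by
  have s5 : x 2 * x 3 = x 3 * x 6 := square (by decide)
  have s4 : x 2 * x 3 = x 0 * x 4 := square (by decide)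
  have s3 : x 5 * x 0 = x 2 * x 6 := square (by decide)
  have s2 : x 6 * x 2 = x 1 * x 4 := square (by decide)
  have s1 : x 6 * x 1 = x 5 * x 6 := square (by decide)
  have s0 : x 1 * x 5 = x 3 * x 4 := square (by decide)
  exact chain (chain (chain (chain (chain s5 s4) s3) s2) s1) s0

lemma rowstep2 : row 4 6 4 6 4 6 * x 1 = x 1 * row 5 2 2 1 6 6 := by
  have s5 : x 6 * x 1 = x 5 * x 6 := square (by decide)
  have s4 : x 4 * x 5 = x 2 * x 6 := square (by decide)
  have s3 : x 6 * x 2 = x 0 * x 1 := square (by decide)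
  have s2 : x 4 * x 0 = x 7 * x 2 := square (by decide)
  have s1 : x 6 * x 7 = x 7 * x 2 := square (by decide)
  have s0 : x 4 * x 7 = x 1 * x 5 := square (by decide)
  exact chain (chain (chain (chain (chain s5 s4) s3) s2) s1) s0

lemma rowstep3 : row 5 2 2 1 6 6 * x 7 = x 7 * row 0 2 0 2 0 2 := by
  have s5 : x 6 * x 7 = x 7 * x 2 := square (by decide)
  have s4 : x 6 * x 7 = x 4 * x 0 := square (by decide)
  have s3 : x 1 * x 4 = x 6 * x 2 := square (by decide)
  have s2 : x 2 * x 6 = x 5 * x 0 := square (by decide)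
  have s1 : x 2 * x 5 = x 1 * x 2 := square (by decide)
  have s0 : x 5 * x 1 = x 7 * x 0 := square (by decide)
  exact chain (chain (chain (chain (chain s5 s4) s3) s2) s1) s0

lemma row0_eq : row 0 2 0 2 0 2 = (x 0 * x 2) ^ 3 := by
  simp only [row, pow_succ, pow_zero, one_mul, mul_assoc]

def gg : Gpos 8 1 5 := (x 0 * x 2) ^ 3

def hh : Gpos 8 1 5 := x 0 * x 2 * x 5 * x 3 * x 1 * x 7

lemma comm_gh : Commute gg hh := by
  have h1 : gg * (x 5 * x 3 * x 1 * x 7) = (x 5 * x 3 * x 1 * x 7) * gg := by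
    unfold gg
    rw [← row0_eq]
    simp only [← mul_assoc]
    rw [rowstep0, mul_assoc (x 5), rowstep1, ← mul_assoc, mul_assoc (x 5 * x 3), rowstep2,
      ← mul_assoc, mul_assoc (x 5 * x 3 * x 1), rowstep3, ← mul_assoc]
  have h2 : Commute gg (x 0 * x 2) := (Commute.refl _).pow_left 3
  have h3 := h2.mul_right (show Commute gg (x 5 * x 3 * x 1 * x 7) from h1)
  have : hh = (x 0 * x 2) * (x 5 * x 3 * x 1 * x 7) := by
    simp only [hh, mul_assoc]
  rw [this]
  exact h3

lemma rho_g (z : ℂ) (hz : Phi z = 0) : (rho z hz gg).val = U3 z := by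
  simp only [gg, map_mul, map_pow, Units.val_pow_eq_pow_val, Units.val_mul, rho_x]
  change (M0 z * M2 z) ^ 3 = _
  rw [u1 z hz, pow_succ, pow_two, u2 z hz, u3 z hz]

lemma rho_h (z : ℂ) (hz : Phi z = 0) : (rho z hz hh).val = H4 z := by
  simp only [hh, map_mul, Units.val_mul, rho_x]
  change M0 z * M2 z * M5 z * M3 z * M1 z * M7 z = _
  rw [u1 z hz, h1 z hz, h2 z hz, h3 z hz, h4 z hz]

lemma T_pow (a b d : ℂ) (n : ℕ) : ∃ b', (T a b 1 d) ^ n = T (n * a) b' 1 (n * d) := by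
  induction n with
  | zero => exact ⟨0, by simp [T_one]⟩
  | succ n ih =>
    obtain ⟨b', h⟩ := ih
    refine ⟨b + n * a * d + b', ?_⟩
    rw [pow_succ, h]
    exact T_mul_eq (by push_cast; ring) rfl (by ring) (by push_cast; ring)

lemma T_pow' (b : ℂ) (n : ℕ) : (T 0 b 1 0) ^ n = T 0 (n * b) 1 0 := by
  induction n with
  | zero => simp [T_one]
  | succ n ih =>
    rw [pow_succ, ih]
    exact T_mul_eq (by ring) (by push_cast; ring) (by ring) (by ring)

lemma T_inj {a b c d a' b' c' d' : ℂ} (h : T a b c d = T a' b' c' d') : a = a' ∧ b = b' := by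
  have h1 := congrFun (congrFun h 0) 1
  have h2 := congrFun (congrFun h 0) 2
  simp [T] at h1 h2
  exact ⟨h1, h2⟩

lemma g_pow_nat (n : ℕ) (h : gg ^ n = 1) : n = 0 := by
  obtain ⟨z, hz⟩ := exists_root
  have h' := congrArg (fun g => (rho z hz g).val) h
  simp only [map_pow, Units.val_pow_eq_pow_val, rho_g, map_one, Units.val_one] at h'
  rw [U3, T_pow', ← T_one] at h'
  have := (T_inj h').2
  exact_mod_cast (mul_eq_zero.mp this).resolve_right (beta_ne z hz)

lemma h_pow_nat (k l : ℕ) (h : hh ^ k = gg ^ l ∨ hh ^ k * gg ^ l = 1) : k = 0 := by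
  obtain ⟨z, hz⟩ := exists_root
  have key : (k : ℂ) * (-15*z - 15*z^3 + 15*z^5 + 15*z^7) = 0 := by
    rcases h with h | h
    · have h' := congrArg (fun g => (rho z hz g).val) h
      simp only [map_pow, Units.val_pow_eq_pow_val, rho_g, rho_h] at h'
      rw [U3, T_pow', H4] at h'
      obtain ⟨b', hb⟩ := T_pow (-15*z - 15*z^3 + 15*z^5 + 15*z^7) (45 + 30*z + 15*z^3 + 45*z^6 - 15*z^7) (-3 + z + 2*z^2 - 2*z^3 + 2*z^4 - 2*z^5 - z^6 + 3*z^7) k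
      rw [hb] at h'
      exact (T_inj h').1
    · have h' := congrArg (fun g => (rho z hz g).val) h
      simp only [map_mul, map_pow, Units.val_mul, Units.val_pow_eq_pow_val, rho_g, rho_h, map_one,
        Units.val_one] at h'
      rw [U3, T_pow', H4] at h'
      obtain ⟨b', hb⟩ := T_pow (-15*z - 15*z^3 + 15*z^5 + 15*z^7) (45 + 30*z + 15*z^3 + 45*z^6 - 15*z^7) (-3 + z + 2*z^2 - 2*z^3 + 2*z^4 - 2*z^5 - z^6 + 3*z^7) k
      rw [hb, T_mul, ← T_one] at h'
      have := (T_inj h').1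
      simpa using this
  exact_mod_cast (mul_eq_zero.mp key).resolve_right (alpha_ne z hz)

lemma indep (m n : ℤ) (h : gg ^ m * hh ^ n = 1) : m = 0 ∧ n = 0 := by
  have hc : gg ^ m * hh ^ n = hh ^ n * gg ^ m := (comm_gh.zpow_zpow m n)
  have hn : n = 0 := by
    obtain ⟨k, rfl | rfl⟩ := Int.eq_nat_or_neg n <;> obtain ⟨l, rfl | rfl⟩ := Int.eq_nat_or_neg m <;>
      simp only [zpow_neg, zpow_natCast] at h hc
    · have := h_pow_nat k l (Or.inr (hc ▸ h)); simp [this]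
    · have := h_pow_nat k l (Or.inl (inv_mul_eq_one.mp h).symm); simp [this]
    · have := h_pow_nat k l (Or.inl (mul_inv_eq_one.mp h).symm); simp [this]
    · rw [← mul_inv_rev, inv_eq_one] at h
      have := h_pow_nat k l (Or.inr h); simp [this]
  subst hn
  refine ⟨?_, rfl⟩
  rw [zpow_zero, mul_one] at h
  obtain ⟨l, rfl | rfl⟩ := Int.eq_nat_or_neg m
  · rw [zpow_natCast] at h
    simp [g_pow_nat l h]
  · rw [zpow_neg, zpow_natCast, inv_eq_one] at h
    simp [g_pow_nat l h]

/-- The embedding of the free abelian group of rank two. -/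
def emb : Multiplicative (ℤ × ℤ) →* Gpos 8 1 5 where
  toFun p := gg ^ (p.toAdd.1) * hh ^ (p.toAdd.2)
  map_one' := by simp
  map_mul' p q := by
    simp only [toAdd_mul, Prod.fst_add, Prod.snd_add, zpow_add]
    have := comm_gh.zpow_zpow (q.toAdd.1) (p.toAdd.2)
    calc _ = gg ^ (p.toAdd.1) * (gg ^ (q.toAdd.1) * hh ^ (p.toAdd.2)) * hh ^ (q.toAdd.2) := by
          simp only [mul_assoc]
      _ = _ := by
          rw [this.eq]
          simp only [mul_assoc]

end G8

theorem stmt12 :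
    ∃ f : Multiplicative (ℤ × ℤ) →* Gpos 8 1 5, Function.Injective f := by
  refine ⟨G8.emb, (injective_iff_map_eq_one _).mpr ?_⟩
  intro p hp
  obtain ⟨h1, h2⟩ := G8.indep _ _ hp
  exact Multiplicative.toAdd.injective (Prod.ext h1 h2)
end

section
/- Let n ≥ 8 be an even integer. In the cyclically presented group G_n(x_0 x_{n/2+2} x_1^{-1}), writing x_i for the image of the generator indexed by i ∈ ZMod n and setting w = x_1 x_{n/2+5} x_{n/2+7} x_{11}, the identity (x_0 x_{n/2}) · w = w · (x_{12} x_{n/2+12}) holds, where all subscripts are read mod n. -/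
/-- The identity already holds for two sequences `X`, `Y` with `X i * Y (i+2) = X (i+1)` and
`Y i * X (i+2) = Y (i+1)`: everything is a word in `X 4, X 5, X 6, X 7`. -/
theorem aux_identity {G : Type*} [Group G] (X Y : ℕ → G)
    (hX : ∀ i, X i * Y (i + 2) = X (i + 1)) (hY : ∀ i, Y i * X (i + 2) = Y (i + 1)) :
    (X 0 * Y 0) * (X 1 * Y 5 * Y 7 * X 11) = (X 1 * Y 5 * Y 7 * X 11) * (X 12 * Y 12) := by
  have hY' : ∀ i, Y (i + 2) = (X i)⁻¹ * X (i + 1) := fun i => by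
    rw [← hX i]; group
  have up : ∀ i, X (i + 4) = (X (i + 1))⁻¹ * X i * (X (i + 1))⁻¹ * X (i + 2) := fun i => by
    have h := hY (i + 2)
    rw [hY' i, show i + 2 + 1 = (i + 1) + 2 from rfl, hY' (i + 1)] at h
    rw [show i + 4 = i + 2 + 2 from rfl, ← inv_mul_eq_of_eq_mul h.symm]
    group
  have down : ∀ i, X i = X (i + 1) * X (i + 4) * (X (i + 2))⁻¹ * X (i + 1) := fun i => by
    rw [up i]; group
  have y1 : Y 1 = Y 2 * (X 3)⁻¹ := by rw [← hY 1]; group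
  have y0 : Y 0 = Y 1 * (X 2)⁻¹ := by rw [← hY 0]; group
  have y2 := hY' 0
  have y5 := hY' 3
  have y7 := hY' 5
  have y12 := hY' 10
  have x3 := down 3
  have x2 := down 2
  have x1 := down 1
  have x0 := down 0
  have x8 := up 4
  have x9 := up 5
  have x10 := up 6
  have x11 := up 7
  have x12 := up 8
  norm_num only at y2 y5 y7 y12 x3 x2 x1 x0 x8 x9 x10 x11 x12
  rw [y12, y0, y1, y2, y5, y7, x12, x11, x10, x9, x8, x0, x1, x2, x3]
  simp only [mul_assoc, mul_inv_rev, inv_inv, inv_mul_cancel_left, mul_inv_cancel_left,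
    mul_inv_cancel, inv_mul_cancel, mul_one, one_mul]

theorem stmt18 (n : ℕ) (hn : 8 ≤ n) (heven : 2 ∣ n) :
    let x : ZMod n → Gneg n ((n / 2 + 2 : ℕ) : ZMod n) 1 := PresentedGroup.of
    let w : Gneg n ((n / 2 + 2 : ℕ) : ZMod n) 1 :=
      x ((1 : ℕ) : ZMod n) * x ((n / 2 + 5 : ℕ) : ZMod n) *
        x ((n / 2 + 7 : ℕ) : ZMod n) * x ((11 : ℕ) : ZMod n)
    (x ((0 : ℕ) : ZMod n) * x ((n / 2 : ℕ) : ZMod n)) * w =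
      w * (x ((12 : ℕ) : ZMod n) * x ((n / 2 + 12 : ℕ) : ZMod n)) := by
  intro x w
  have hrel : ∀ i : ZMod n, x i * x (i + ((n / 2 + 2 : ℕ) : ZMod n)) = x (i + 1) := fun i => by
    have h : PresentedGroup.mk (negRels n ((n / 2 + 2 : ℕ) : ZMod n) 1)
        (FreeGroup.of i * FreeGroup.of (i + ((n / 2 + 2 : ℕ) : ZMod n)) *
          (FreeGroup.of (i + 1))⁻¹) = 1 :=
      PresentedGroup.one_of_mem ⟨i, rfl⟩
    rw [map_mul, map_mul, map_inv] at h
    exact mul_inv_eq_one.mp h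
  have hm : ((n / 2 : ℕ) : ZMod n) + ((n / 2 : ℕ) : ZMod n) = 0 := by
    rw [← Nat.cast_add, show n / 2 + n / 2 = n by omega, ZMod.natCast_self]
  have key := aux_identity (fun i : ℕ => x (i : ZMod n))
    (fun i : ℕ => x ((n / 2 + i : ℕ) : ZMod n))
    (fun i => by
      have h := hrel (i : ZMod n)
      have e : ((n / 2 + (i + 2) : ℕ) : ZMod n) = i + ((n / 2 + 2 : ℕ) : ZMod n) := by
        push_cast; ring
      simp only [e, h]
      push_cast; rfl)
    (fun i => by
      have h := hrel ((n / 2 + i : ℕ) : ZMod n)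
      have e : ((i + 2 : ℕ) : ZMod n) =
          ((n / 2 + i : ℕ) : ZMod n) + ((n / 2 + 2 : ℕ) : ZMod n) := by
        rw [Nat.cast_add (n / 2), Nat.cast_add (n / 2), add_add_add_comm, hm]
        push_cast; ring
      have e' : ((n / 2 + (i + 1) : ℕ) : ZMod n) = ((n / 2 + i : ℕ) : ZMod n) + 1 := by
        push_cast; ring
      simp only [e, e', h])
  exact key
end

section
/- Let n ≥ 8 be an even integer with n ≠ 10. Then the cyclically presented group G_n(x_0 x_{n/2+2} x_1^{-1}) contains a free abelian subgroup of rank 2; that is, there exists an injective group homomorphism from ℤ × ℤ into G_n(x_0 x_{n/2+2} x_1^{-1}). -/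
section General

/-- The products `x_2 x_5 x_8 ⋯` with `m` factors. -/
def stairWord {H R : Type*} [Group H] [CommRing R] (x : R → H) : ℕ → H
  | 0 => 1
  | m + 1 => stairWord x m * x (2 + 3 * (m : R))

theorem conj_rel {H R : Type*} [Group H] [CommRing R] (κ : R) (hκ : κ + κ = 0) (x : R → H)
    (h : ∀ i, x i * x (i + (κ + 2)) = x (i + 1)) (i : R) :
    x i * x (i + κ) * x (i + 2) = x (i + 2) * (x (i + 3) * x (i + 3 + κ))⁻¹ := by
  have h1 : x (i + κ) * x (i + 2) = x (i + κ + 1) := by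
    have := h (i + κ)
    rwa [show i + κ + (κ + 2) = i + 2 by linear_combination hκ] at this
  have h2 : x (i + κ + 1) * x (i + 3) = x (i + (κ + 2)) := by
    have := h (i + κ + 1)
    rwa [show i + κ + 1 + (κ + 2) = i + 3 by linear_combination hκ,
      show i + κ + 1 + 1 = i + (κ + 2) by ring] at this
  have h3 := h i
  have h4 : x (i + 1) * x (i + 3 + κ) = x (i + 2) := by
    have := h (i + 1)
    rwa [show i + 1 + (κ + 2) = i + 3 + κ by ring, show i + 1 + 1 = i + 2 by ring] at this
  rw [eq_mul_inv_iff_mul_eq]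
  calc x i * x (i + κ) * x (i + 2) * (x (i + 3) * x (i + 3 + κ))
      = x i * ((x (i + κ) * x (i + 2)) * x (i + 3)) * x (i + 3 + κ) := by group
    _ = x (i + 2) := by rw [h1, h2, h3, h4]

theorem stair_conj {H R : Type*} [Group H] [CommRing R] (κ : R) (hκ : κ + κ = 0) (x : R → H)
    (h : ∀ i, x i * x (i + (κ + 2)) = x (i + 1)) (m : ℕ) :
    (x 0 * x κ) * stairWord x (2 * m) =
      stairWord x (2 * m) * (x (6 * (m : R)) * x (6 * (m : R) + κ)) := by
  induction m with
  | zero => simp [stairWord]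
  | succ m ih =>
    have e1 := conj_rel κ hκ x h (6 * (m : R))
    have e2 := conj_rel κ hκ x h (6 * (m : R) + 3)
    have e3 : (x (6 * (m : R) + 3) * x (6 * (m : R) + 3 + κ))⁻¹ * x (6 * (m : R) + 3 + 2)
        = x (6 * (m : R) + 3 + 2) * (x (6 * (m : R) + 3 + 3) * x (6 * (m : R) + 3 + 3 + κ)) := by
      rw [inv_mul_eq_iff_eq_mul, ← mul_assoc, e2, inv_mul_cancel_right]
    have hs : stairWord x (2 * (m + 1)) =
        stairWord x (2 * m) * x (6 * (m : R) + 2) * x (6 * (m : R) + 3 + 2) := by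
      rw [show 2 * (m + 1) = 2 * m + 1 + 1 by ring]
      simp only [stairWord]
      congr 2
      · congr 1; push_cast; ring
      · push_cast; ring
    rw [hs, show (6 * ((m + 1 : ℕ) : R)) = 6 * (m : R) + 3 + 3 by push_cast; ring]
    calc _ = (x 0 * x κ * stairWord x (2 * m)) * x (6 * (m : R) + 2) * x (6 * (m : R) + 3 + 2) := by
          group
      _ = stairWord x (2 * m) * (x (6 * (m : R)) * x (6 * (m : R) + κ) * x (6 * (m : R) + 2))
            * x (6 * (m : R) + 3 + 2) := by rw [ih]; group
      _ = stairWord x (2 * m) * x (6 * (m : R) + 2) *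
            ((x (6 * (m : R) + 3) * x (6 * (m : R) + 3 + κ))⁻¹ * x (6 * (m : R) + 3 + 2)) := by
          rw [e1]; group
      _ = _ := by rw [e3]; group

theorem map_stair {H K R : Type*} [Group H] [Group K] [CommRing R] (f : H →* K) (x : R → H)
    (m : ℕ) : f (stairWord x m) = stairWord (fun i => f (x i)) m := by
  induction m with
  | zero => simp [stairWord]
  | succ m ih => simp [stairWord, ih]

/-- It suffices to detect independence in some target group. -/
theorem main_criterion (k : ℕ) {H : Type*} [Group H] (y : ZMod (2 * k) → H)
    (hy : ∀ i, y i * y (i + ((k : ZMod (2 * k)) + 2)) = y (i + 1))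
    (hind : ∀ p q : ℤ, (y 0 * y (k : ZMod (2 * k))) ^ p * (stairWord y (2 * k)) ^ q = 1 →
      p = 0 ∧ q = 0) :
    ∃ f : Multiplicative (ℤ × ℤ) →* Gneg (2 * k) ((2 * k / 2 + 2 : ℕ) : ZMod (2 * k)) 1,
      Function.Injective f := by
  have hk : 2 * k / 2 = k := by omega
  rw [hk]
  set κ : ZMod (2 * k) := (k : ZMod (2 * k)) with hκdef
  have hκ : κ + κ = 0 := by
    have := ZMod.natCast_self (2 * k)
    push_cast at this
    rw [hκdef]; linear_combination this
  have hm : ((k + 2 : ℕ) : ZMod (2 * k)) = κ + 2 := by push_cast; rfl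
  rw [hm]
  let x : ZMod (2 * k) → Gneg (2 * k) (κ + 2) 1 := fun i => PresentedGroup.of i
  have hx : ∀ i, x i * x (i + (κ + 2)) = x (i + 1) := by
    intro i
    have : PresentedGroup.mk (negRels (2 * k) (κ + 2) 1)
        (FreeGroup.of i * FreeGroup.of (i + (κ + 2)) * (FreeGroup.of (i + 1))⁻¹) = 1 :=
      PresentedGroup.one_of_mem ⟨i, rfl⟩
    rw [map_mul, map_mul, map_inv, mul_inv_eq_one] at this
    exact this
  let F : Gneg (2 * k) (κ + 2) 1 →* H := PresentedGroup.toGroup (f := y) (by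
    rintro r ⟨i, rfl⟩
    simp [hy i])
  have hF : ∀ i, F (x i) = y i := fun i => PresentedGroup.toGroup.of _
  set A := x 0 * x κ
  set B := stairWord x (2 * k)
  have hFA : F A = y 0 * y κ := by simp [A, hF]
  have hFB : F B = stairWord y (2 * k) := by
    rw [map_stair]; congr 1; funext i; exact hF i
  have hAB : A * B = B * A := by
    have := stair_conj κ hκ x hx k
    rw [show (6 * (k : ZMod (2 * k))) = 0 by linear_combination 3 * hκ, zero_add] at this
    exact this
  have hc : Commute A B := hAB
  refine ⟨{ toFun := fun v => A ^ (Multiplicative.toAdd v).1 * B ^ (Multiplicative.toAdd v).2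
            map_one' := by simp
            map_mul' := ?_ }, ?_⟩
  · intro u v
    simp only [toAdd_mul, Prod.fst_add, Prod.snd_add, zpow_add]
    have := (hc.zpow_zpow (Multiplicative.toAdd v).1 (Multiplicative.toAdd u).2).eq
    simp only [mul_assoc]
    rw [← mul_assoc (B ^ _) (A ^ _), ← this]
    simp only [mul_assoc]
  · rw [injective_iff_map_eq_one]
    intro v hv
    have := hind (Multiplicative.toAdd v).1 (Multiplicative.toAdd v).2 (by
      rw [← hFA, ← hFB, ← map_zpow, ← map_zpow, ← map_mul]
      exact (congrArg F hv).trans (map_one F))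
    apply Multiplicative.toAdd.injective
    exact Prod.ext this.1 this.2

end General

section Trefoil

variable {Γ : Type*} [Group Γ]

/-- The images of the generators in a quotient of the trefoil group. -/
def trefoilGen (k : ℕ) (t a : Γ) (i : ZMod (2 * k)) : Γ := t ^ i.val * a * (t ^ i.val)⁻¹

theorem trefoilGen_cast (k : ℕ) (t a : Γ) (ht : Commute (t ^ k) a) (m : ℕ) :
    trefoilGen k t a (m : ZMod (2 * k)) = t ^ m * a * (t ^ m)⁻¹ := by
  unfold trefoilGen
  rw [ZMod.val_natCast]
  have h1 : Commute (t ^ (2 * k * (m / (2 * k)))) a := by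
    rw [show 2 * k * (m / (2 * k)) = k * (2 * (m / (2 * k))) by ring, pow_mul]
    exact ht.pow_left _
  conv_rhs => rw [← Nat.mod_add_div m (2 * k), pow_add]
  rw [mul_assoc (t ^ (m % (2 * k))) _ a, h1.eq]
  group

theorem trefoil_rel (p q t a : Γ) (hpq : p ^ 2 = q ^ 3) (ht : t * q = p)
    (ha : a * t ^ 2 = q) : a * t ^ 2 * a = t * a * t := by
  have ha' : a = q * t⁻¹ * t⁻¹ := by rw [← ha]; group
  have ht' : t = p * q⁻¹ := by rw [← ht]; group
  have e1 : t * a * t = p * q * p⁻¹ := by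
    rw [ha', ← ht]; group
  rw [e1, ha, ha', ht']
  have : p * p = q * q * q := by rw [← pow_two, hpq, pow_succ, pow_two]
  calc q * (q * (p * q⁻¹)⁻¹ * (p * q⁻¹)⁻¹) = (q * q * q) * p⁻¹ * q * p⁻¹ := by group
    _ = _ := by rw [← this]; group

theorem trefoilGen_rel (k : ℕ) (hk : 0 < k) (p q t a : Γ) (hpq : p ^ 2 = q ^ 3) (ht : t * q = p)
    (ha : a * t ^ 2 = q) (hc : Commute (t ^ k) a) (i : ZMod (2 * k)) :
    trefoilGen k t a i * trefoilGen k t a (i + ((k : ZMod (2 * k)) + 2)) =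
      trefoilGen k t a (i + 1) := by
  have : NeZero (2 * k) := ⟨by omega⟩
  obtain ⟨m, rfl⟩ : ∃ m : ℕ, (m : ZMod (2 * k)) = i := ⟨i.val, ZMod.natCast_zmod_val i⟩
  have e1 : ((m : ZMod (2 * k)) + ((k : ZMod (2 * k)) + 2)) = ((m + 2 + k : ℕ) : ZMod (2 * k)) := by
    push_cast; ring
  have e2 : ((m : ZMod (2 * k)) + 1) = ((m + 1 : ℕ) : ZMod (2 * k)) := by push_cast; ring
  rw [e1, e2, trefoilGen_cast k t a hc, trefoilGen_cast k t a hc, trefoilGen_cast k t a hc]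
  have h3 : t ^ (m + 2 + k) * a * (t ^ (m + 2 + k))⁻¹ = t ^ (m + 2) * a * (t ^ (m + 2))⁻¹ := by
    rw [pow_add t (m + 2) k, mul_assoc _ (t ^ k) a, hc.eq]; group
  rw [h3]
  have h4 := trefoil_rel p q t a hpq ht ha
  calc t ^ m * a * (t ^ m)⁻¹ * (t ^ (m + 2) * a * (t ^ (m + 2))⁻¹)
      = t ^ m * (a * t ^ 2 * a) * (t ^ (m + 2))⁻¹ := by
        rw [pow_add]; group
    _ = _ := by rw [h4, pow_add, pow_add]; group

theorem trefoil_stair (k : ℕ) (t a : Γ) (hc : Commute (t ^ k) a) (m : ℕ) :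
    stairWord (trefoilGen k t a) m = (t ^ 2 * a * t) ^ m * (t ^ (3 * m))⁻¹ := by
  induction m with
  | zero => simp [stairWord]
  | succ m ih =>
    have e : (2 + 3 * (m : ZMod (2 * k))) = ((2 + 3 * m : ℕ) : ZMod (2 * k)) := by push_cast; ring
    rw [stairWord, ih, e, trefoilGen_cast k t a hc, pow_succ (t ^ 2 * a * t) m,
      show 3 * (m + 1) = 1 + (2 + 3 * m) by ring, pow_add t 1 _, show 2 + 3 * m = 3 * m + 2 by ring,
      pow_add t (3 * m) 2]
    group

theorem trefoil_stair_top (k : ℕ) (p q t a : Γ) (hpq : p ^ 2 = q ^ 3) (ht : t * q = p)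
    (ha : a * t ^ 2 = q) (hc : Commute (t ^ k) a) :
    stairWord (trefoilGen k t a) (2 * k) = (p ^ 2) ^ k * ((t ^ k) ^ 6)⁻¹ := by
  have h1 : t ^ 2 * a * t = t * p * t⁻¹ := by
    have ha' : a = q * t⁻¹ * t⁻¹ := by rw [← ha]; group
    rw [ha', ← ht, pow_two]; group
  have h2 : Commute t (p ^ 2) := by
    have ht' : t = p * q⁻¹ := by rw [← ht]; group
    rw [ht']
    refine Commute.mul_left (Commute.self_pow p 2) ?_
    rw [hpq]
    exact (Commute.self_pow q 3).inv_left
  rw [trefoil_stair k t a hc, h1, pow_mul, conj_pow, h2.eq, mul_inv_cancel_right, ← pow_mul t k 6,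
    show 3 * (2 * k) = k * 6 by ring]

end Trefoil

section Trace

open Matrix

theorem trace_pow_gt (M : Matrix (Fin 2) (Fin 2) ℝ) (hdet : M.det = 1) (htr : 2 < M.trace)
    (m : ℕ) : 2 ≤ (M ^ m).trace ∧ (M ^ m).trace < (M ^ (m + 1)).trace := by
  have hsq : M * M = M.trace • M - 1 := by
    rw [Matrix.det_fin_two] at hdet
    ext i j
    fin_cases i <;> fin_cases j <;>
      simp [Matrix.mul_apply, Fin.sum_univ_two, Matrix.trace_fin_two] <;> linarith
  induction m with
  | zero => simpa [Matrix.trace_one] using htr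
  | succ m ih =>
    obtain ⟨h1, h2⟩ := ih
    have : (M ^ (m + 1 + 1)).trace = M.trace * (M ^ (m + 1)).trace - (M ^ m).trace := by
      rw [pow_succ, pow_succ, mul_assoc, hsq, mul_sub, Matrix.trace_sub, mul_one, mul_smul_comm,
        Matrix.trace_smul, smul_eq_mul]
    refine ⟨by linarith, ?_⟩
    rw [this]
    nlinarith

theorem zpow_ne_one_of_trace (g : SpecialLinearGroup (Fin 2) ℝ)
    (htr : 2 < (g : Matrix (Fin 2) (Fin 2) ℝ).trace) (m : ℤ) (hm : g ^ m = 1) : m = 0 := by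
  by_contra h0
  have h1 : g ^ m.natAbs = 1 := by
    rcases Int.natAbs_eq m with h | h
    · rw [h, zpow_natCast] at hm; exact hm
    · rw [h, _root_.zpow_neg, inv_eq_one, zpow_natCast] at hm; exact hm
  obtain ⟨j, hj⟩ : ∃ j, m.natAbs = j + 1 := ⟨m.natAbs - 1, by omega⟩
  have h2 := trace_pow_gt (g : Matrix (Fin 2) (Fin 2) ℝ) g.det_coe htr j
  have h3 : ((g : Matrix (Fin 2) (Fin 2) ℝ)) ^ (j + 1) = 1 := by
    rw [hj] at h1
    calc _ = ((g ^ (j + 1) : SpecialLinearGroup (Fin 2) ℝ) : Matrix (Fin 2) (Fin 2) ℝ) :=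
          (Matrix.SpecialLinearGroup.coe_pow g (j + 1)).symm
      _ = 1 := by rw [h1]; rfl
  rw [h3] at h2
  have : (1 : Matrix (Fin 2) (Fin 2) ℝ).trace = 2 := by simp
  linarith [h2.1, h2.2]

end Trace

section Lift

open UpperHalfPlane Matrix

/-- The automorphy factor. -/
noncomputable def autFac (g : SpecialLinearGroup (Fin 2) ℝ) (z : ℍ) : ℂ :=
  (g 1 0 : ℂ) * z + (g 1 1 : ℂ)

theorem autFac_ne_zero (g : SpecialLinearGroup (Fin 2) ℝ) (z : ℍ) : autFac g z ≠ 0 := by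
  intro h
  have him := congrArg Complex.im h
  have hre := congrArg Complex.re h
  simp [autFac] at him hre
  have hz : (z : ℂ).im ≠ 0 := z.im_ne_zero
  have hz' : z.im ≠ 0 := z.im_ne_zero
  have h10 : g 1 0 = 0 := by tauto
  have hd := g.det_coe
  rw [Matrix.det_fin_two] at hd
  rw [h10] at hre
  simp at hre
  rw [h10, hre] at hd
  simp at hd

theorem sl_mul_apply (g h : SpecialLinearGroup (Fin 2) ℝ) (i j : Fin 2) :
    (g * h) i j = g i 0 * h 0 j + g i 1 * h 1 j := by
  change ((g : Matrix (Fin 2) (Fin 2) ℝ) * (h : Matrix (Fin 2) (Fin 2) ℝ)) i j = _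
  rw [Matrix.mul_apply, Fin.sum_univ_two]

theorem autFac_mul (g h : SpecialLinearGroup (Fin 2) ℝ) (z : ℍ) :
    autFac (g * h) z = autFac g (h • z) * autFac h z := by
  have hne := autFac_ne_zero h z
  unfold autFac at *
  rw [UpperHalfPlane.coe_specialLinearGroup_apply, sl_mul_apply, sl_mul_apply]
  simp only [Algebra.algebraMap_self, RingHom.id_apply]
  rw [add_mul, mul_assoc _ _ (_ + _), div_mul_cancel₀ _ hne]
  push_cast
  ring

theorem autFac_arg (g : SpecialLinearGroup (Fin 2) ℝ) (hg : 0 < g 1 0) (z : ℍ) :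
    0 < (autFac g z).arg ∧ (autFac g z).arg < Real.pi := by
  have him : 0 < (autFac g z).im := by
    simp [autFac]
    exact mul_pos hg z.im_pos
  refine ⟨lt_of_le_of_ne (Complex.arg_nonneg_iff.2 him.le) ?_,
    lt_of_le_of_ne (Complex.arg_le_pi _) ?_⟩
  · intro h
    have := (Complex.arg_eq_zero_iff.1 h.symm).2
    exact him.ne' this
  · intro h
    have := (Complex.arg_eq_pi_iff.1 h).2
    exact him.ne' this

/-- The lift of a matrix to the universal covering. -/
noncomputable def liftPerm (g : SpecialLinearGroup (Fin 2) ℝ) : Equiv.Perm (ℍ × ℝ) where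
  toFun v := (g • v.1, v.2 + (autFac g v.1).arg)
  invFun v := (g⁻¹ • v.1, v.2 - (autFac g (g⁻¹ • v.1)).arg)
  left_inv v := by simp
  right_inv v := by simp

/-- Vertical translations. -/
noncomputable def shiftPerm (r : ℝ) : Equiv.Perm (ℍ × ℝ) where
  toFun v := (v.1, v.2 + r)
  invFun v := (v.1, v.2 - r)
  left_inv v := by simp
  right_inv v := by simp

theorem arg_add_mod (u v : ℂ) (hu : u ≠ 0) (hv : v ≠ 0) :
    ∃ j : ℤ, u.arg + v.arg = (u * v).arg + j * (2 * Real.pi) := by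
  have h := Complex.arg_mul_coe_angle hu hv
  rw [← Real.Angle.coe_add, Real.Angle.angle_eq_iff_two_pi_dvd_sub] at h
  obtain ⟨j, hj⟩ := h
  exact ⟨-j, by push_cast; linarith⟩

theorem liftPerm_mul (g h : SpecialLinearGroup (Fin 2) ℝ) (hg : 0 < g 1 0) (hh : 0 < h 1 0)
    (hgh : 0 < (g * h) 1 0) : liftPerm g * liftPerm h = liftPerm (g * h) := by
  ext1 v
  obtain ⟨z, r⟩ := v
  simp only [Equiv.Perm.mul_apply, liftPerm, Equiv.coe_fn_mk, mul_smul]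
  congr 1
  obtain ⟨j, hj⟩ := arg_add_mod _ _ (autFac_ne_zero g (h • z)) (autFac_ne_zero h z)
  rw [← autFac_mul] at hj
  have h1 := autFac_arg g hg (h • z)
  have h2 := autFac_arg h hh z
  have h3 := autFac_arg _ hgh z
  have hpi := Real.pi_pos
  have hj1 : j < 1 := by
    by_contra hc
    have : (1 : ℝ) ≤ j := by exact_mod_cast not_lt.1 hc
    nlinarith
  have hj2 : -1 < j := by
    by_contra hc
    have : (j : ℝ) ≤ -1 := by exact_mod_cast not_lt.1 hc
    nlinarith
  have : j = 0 := by omega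
  rw [this] at hj
  simp at hj
  linarith

theorem liftPerm_mul_neg_one (g h : SpecialLinearGroup (Fin 2) ℝ) (hg : 0 < g 1 0)
    (hh : 0 < h 1 0) (hgh : g * h = -1) : liftPerm g * liftPerm h = shiftPerm Real.pi := by
  ext1 v
  obtain ⟨z, r⟩ := v
  simp only [Equiv.Perm.mul_apply, liftPerm, shiftPerm, Equiv.coe_fn_mk]
  have e : g • h • z = z := by
    rw [← mul_smul, hgh, ← one_smul (SpecialLinearGroup (Fin 2) ℝ) z]
    ext
    simp [UpperHalfPlane.coe_specialLinearGroup_apply]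
  rw [e]
  congr 1
  obtain ⟨j, hj⟩ := arg_add_mod _ _ (autFac_ne_zero g (h • z)) (autFac_ne_zero h z)
  rw [← autFac_mul, hgh] at hj
  have hm : autFac (-1) z = -1 := by simp [autFac]
  rw [hm, Complex.arg_neg_one] at hj
  have h1 := autFac_arg g hg (h • z)
  have h2 := autFac_arg h hh z
  have hpi := Real.pi_pos
  have hj1 : j < 1 := by
    by_contra hc
    have : (1 : ℝ) ≤ j := by exact_mod_cast not_lt.1 hc
    nlinarith
  have hj2 : -1 < j := by
    by_contra hc
    have : (j : ℝ) ≤ -1 := by exact_mod_cast not_lt.1 hc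
    nlinarith
  have : j = 0 := by omega
  rw [this] at hj
  simp at hj
  linarith

theorem shiftPerm_zpow (r : ℝ) (m : ℤ) : shiftPerm r ^ m = shiftPerm (m * r) := by
  have hadd : ∀ a b, shiftPerm a * shiftPerm b = shiftPerm (a + b) := by
    intro a b
    ext1 v
    simp [shiftPerm, add_assoc, add_comm b a]
  have h0 : shiftPerm 0 = 1 := by ext1 v; simp [shiftPerm]
  let F : Multiplicative ℝ →* Equiv.Perm (ℍ × ℝ) :=
    { toFun := fun a => shiftPerm a.toAdd, map_one' := h0, map_mul' := fun a b => (hadd _ _).symm }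
  have := map_zpow F (Multiplicative.ofAdd r) m
  rw [← ofAdd_zsmul] at this
  simpa [F] using this.symm

theorem shiftPerm_eq_one (r : ℝ) (h : shiftPerm r = 1) : r = 0 := by
  have := congrArg (fun f : Equiv.Perm (ℍ × ℝ) => (f (UpperHalfPlane.I, 0)).2) h
  simpa [shiftPerm] using this

theorem shiftPerm_commute (r : ℝ) (g : SpecialLinearGroup (Fin 2) ℝ) :
    Commute (shiftPerm r) (liftPerm g) := by
  ext1 v
  simp [shiftPerm, liftPerm]
  ring

end Lift

section Large

open UpperHalfPlane Matrix

/-- Rotation matrices. -/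
noncomputable def rotSL (x : ℝ) : SpecialLinearGroup (Fin 2) ℝ :=
  ⟨!![Real.cos x, -Real.sin x; Real.sin x, Real.cos x], by
    rw [Matrix.det_fin_two_of]
    nlinarith [Real.sin_sq_add_cos_sq x]⟩

theorem rotSL_add (x y : ℝ) : rotSL x * rotSL y = rotSL (x + y) := by
  ext i j
  rw [sl_mul_apply]
  fin_cases i <;> fin_cases j <;> simp [rotSL, Real.cos_add, Real.sin_add] <;> ring

theorem rotSL_pi : rotSL Real.pi = -1 := by
  ext i j
  fin_cases i <;> fin_cases j <;> simp [rotSL]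

theorem rotSL_zero : rotSL 0 = 1 := by
  ext i j
  fin_cases i <;> fin_cases j <;> simp [rotSL]

theorem rotSL_pow (x : ℝ) (j : ℕ) : rotSL x ^ j = rotSL (j * x) := by
  induction j with
  | zero => simp [rotSL_zero]
  | succ j ih => rw [pow_succ, ih, rotSL_add]; congr 1; push_cast; ring

theorem lift_rot_pow (k : ℕ) (hk : 2 ≤ k) (j : ℕ) (hj : j + 1 < k) :
    liftPerm (rotSL (Real.pi / k)) ^ (j + 1) = liftPerm (rotSL ((j + 1 : ℕ) * (Real.pi / k))) := by
  have hk0 : (0 : ℝ) < k := by exact_mod_cast (by omega : 0 < k)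
  have hpos : ∀ i : ℕ, i + 1 < k → 0 < rotSL ((i + 1 : ℕ) * (Real.pi / k)) 1 0 := by
    intro i hi
    have : 0 < Real.sin ((i + 1 : ℕ) * (Real.pi / k)) := by
      apply Real.sin_pos_of_pos_of_lt_pi
      · have := Real.pi_pos
        positivity
      · have h1 : ((i + 1 : ℕ) : ℝ) < k := by exact_mod_cast hi
        rw [← mul_div_assoc, div_lt_iff₀ hk0]
        nlinarith [Real.pi_pos]
    simpa [rotSL] using this
  induction j with
  | zero => simp
  | succ j ih =>
    have e : rotSL ((j + 1 : ℕ) * (Real.pi / k)) * rotSL (Real.pi / k) =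
        rotSL ((j + 1 + 1 : ℕ) * (Real.pi / k)) := by
      rw [rotSL_add]; congr 1; push_cast; ring
    rw [pow_succ, ih (by omega), liftPerm_mul, e]
    · exact hpos j (by omega)
    · simpa using hpos 0 (by omega)
    · rw [e]; exact hpos (j + 1) hj

theorem lift_rot_pow_top (k : ℕ) (hk : 2 ≤ k) :
    liftPerm (rotSL (Real.pi / k)) ^ k = shiftPerm Real.pi := by
  have hk0 : (0 : ℝ) < k := by exact_mod_cast (by omega : 0 < k)
  obtain ⟨j, rfl⟩ : ∃ j, k = j + 1 + 1 := ⟨k - 2, by omega⟩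
  have hpi := Real.pi_pos
  rw [pow_succ, lift_rot_pow _ hk j (by omega), liftPerm_mul_neg_one]
  · have : 0 < Real.sin ((j + 1 : ℕ) * (Real.pi / (j + 1 + 1 : ℕ))) := by
      apply Real.sin_pos_of_pos_of_lt_pi
      · positivity
      · rw [← mul_div_assoc, div_lt_iff₀ hk0]
        push_cast
        nlinarith
    simpa [rotSL] using this
  · have : 0 < Real.sin (Real.pi / (j + 1 + 1 : ℕ)) := by
      apply Real.sin_pos_of_pos_of_lt_pi
      · positivity
      · rw [div_lt_iff₀ hk0]
        push_cast
        nlinarith [mul_nonneg hpi.le (Nat.cast_nonneg (α := ℝ) j)]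
    simpa [rotSL] using this
  · rw [rotSL_add, ← rotSL_pi]
    congr 1
    field_simp
    push_cast
    ring

theorem large_case (k : ℕ) (hk : 7 ≤ k) :
    ∃ f : Multiplicative (ℤ × ℤ) →* Gneg (2 * k) ((2 * k / 2 + 2 : ℕ) : ZMod (2 * k)) 1,
      Function.Injective f := by
  have hk0 : (0 : ℝ) < k := by exact_mod_cast (by omega : 0 < k)
  have hk7 : (7 : ℝ) ≤ k := by exact_mod_cast hk
  have hpi := Real.pi_pos
  set θ := Real.pi / k with hθ
  have hθ0 : 0 < θ := by positivity
  have hθ6 : θ < Real.pi / 6 := by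
    rw [hθ]
    gcongr
    linarith
  obtain ⟨s, hs⟩ : ∃ s, s = Real.sin θ := ⟨_, rfl⟩
  obtain ⟨c, hc⟩ : ∃ c, c = Real.cos θ := ⟨_, rfl⟩
  have hs0 : 0 < s := by rw [hs]; exact Real.sin_pos_of_pos_of_lt_pi hθ0 (by linarith)
  have hc0 : 0 < c := by rw [hc]; exact Real.cos_pos_of_mem_Ioo ⟨by linarith, by linarith⟩
  have hs2 : s < 1 / 2 := by
    rw [hs, ← Real.sin_pi_div_six]
    exact Real.sin_lt_sin_of_lt_of_le_pi_div_two (by linarith) (by linarith) hθ6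
  have hsc : s ^ 2 + c ^ 2 = 1 := by rw [hs, hc]; exact Real.sin_sq_add_cos_sq θ
  obtain ⟨γ, hγ0, hγ⟩ : ∃ γ : ℝ, 0 < γ ∧ s * (γ + γ⁻¹) = 1 := by
    have hd : 0 ≤ 1 - 4 * s ^ 2 := by nlinarith
    have hr := Real.sq_sqrt hd
    have hr0 := Real.sqrt_nonneg (1 - 4 * s ^ 2)
    set r := Real.sqrt (1 - 4 * s ^ 2)
    have hg : 0 < (1 + r) / (2 * s) := by positivity
    refine ⟨(1 + r) / (2 * s), hg, ?_⟩
    field_simp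
    nlinarith
  let P : SpecialLinearGroup (Fin 2) ℝ := ⟨!![0, -γ⁻¹; γ, 0], by
    rw [Matrix.det_fin_two_of]; field_simp; ring⟩
  let Q : SpecialLinearGroup (Fin 2) ℝ := ⟨!![s * γ, -(c * γ⁻¹); c * γ, s * γ⁻¹], by
    rw [Matrix.det_fin_two_of]; field_simp; linarith⟩
  let T := rotSL θ
  have hP : 0 < P 1 0 := by simpa [P] using hγ0
  have hQ : 0 < Q 1 0 := by simpa [Q] using mul_pos hc0 hγ0
  have hT : 0 < T 1 0 := by simpa [T, rotSL, ← hs] using hs0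
  have hTQ : T * Q = P := by
    ext i j
    rw [sl_mul_apply]
    fin_cases i <;> fin_cases j <;> simp [T, P, Q, rotSL, ← hs, ← hc]
    · ring
    · field_simp; linarith
    · linear_combination γ * hsc
    · ring
  have hPP : P * P = -1 := by
    ext i j
    rw [sl_mul_apply]
    fin_cases i <;> fin_cases j <;> simp [P, hγ0.ne']
  have hQ2 : ∀ i j, (Q * Q) i j = Q i j - (1 : SpecialLinearGroup (Fin 2) ℝ) i j := by
    intro i j
    have hgi : γ * γ⁻¹ = 1 := mul_inv_cancel₀ hγ0.ne'
    rw [sl_mul_apply]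
    fin_cases i <;> fin_cases j <;> simp [Q]
    · linear_combination s * γ * hγ - (s ^ 2 + c ^ 2) * hgi - hsc
    · linear_combination - c * γ⁻¹ * hγ
    · linear_combination c * γ * hγ
    · linear_combination s * γ⁻¹ * hγ - (s ^ 2 + c ^ 2) * hgi - hsc
  have hQQ : 0 < (Q * Q) 1 0 := by rw [hQ2]; simpa using hQ
  have hQQQ : Q * Q * Q = -1 := by
    ext i j
    rw [sl_mul_apply, hQ2, hQ2]
    have := hQ2 i j
    rw [sl_mul_apply] at this
    fin_cases i <;> fin_cases j <;> simp at this ⊢ <;> linarith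
  let p : SpecialLinearGroup (Fin 2) ℝ × Equiv.Perm (ℍ × ℝ) := (P, liftPerm P)
  let q : SpecialLinearGroup (Fin 2) ℝ × Equiv.Perm (ℍ × ℝ) := (Q, liftPerm Q)
  let t : SpecialLinearGroup (Fin 2) ℝ × Equiv.Perm (ℍ × ℝ) := (T, liftPerm T)
  let a := q * (t ^ 2)⁻¹
  have hp2 : p ^ 2 = (-1, shiftPerm Real.pi) := by
    rw [pow_two]
    exact Prod.ext hPP (liftPerm_mul_neg_one P P hP hP hPP)
  have hq3 : q ^ 3 = (-1, shiftPerm Real.pi) := by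
    rw [pow_succ, pow_two]
    refine Prod.ext hQQQ ?_
    change liftPerm Q * liftPerm Q * liftPerm Q = _
    rw [liftPerm_mul Q Q hQ hQ hQQ, liftPerm_mul_neg_one _ _ hQQ hQ hQQQ]
  have htq : t * q = p := by
    refine Prod.ext hTQ ?_
    change liftPerm T * liftPerm Q = liftPerm P
    rw [liftPerm_mul T Q hT hQ (by rw [hTQ]; exact hP), hTQ]
  have ha : a * t ^ 2 = q := by simp [a]
  have htk : t ^ k = (-1, shiftPerm Real.pi) := by
    refine Prod.ext ?_ (lift_rot_pow_top k (by omega))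
    change rotSL θ ^ k = -1
    rw [rotSL_pow, ← rotSL_pi]
    congr 1
    rw [hθ]; field_simp
  have hcen : ∀ g : SpecialLinearGroup (Fin 2) ℝ,
      Commute ((-1, shiftPerm Real.pi) : SpecialLinearGroup (Fin 2) ℝ × Equiv.Perm (ℍ × ℝ))
        (g, liftPerm g) := by
    intro g
    refine Prod.ext ?_ (shiftPerm_commute _ g)
    simp
  have hcomm : Commute (t ^ k) a := by
    rw [htk]
    exact (hcen Q).mul_right ((hcen T).pow_right 2).inv_right
  have hpq : p ^ 2 = q ^ 3 := by rw [hp2, hq3]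
  refine main_criterion k (trefoilGen k t a)
    (trefoilGen_rel k (by omega) p q t a hpq htq ha hcomm) ?_
  intro m l hml
  have hA : trefoilGen k t a 0 * trefoilGen k t a (k : ZMod (2 * k)) = a * a := by
    have h0 := trefoilGen_cast k t a hcomm 0
    rw [trefoilGen_cast k t a hcomm, hcomm.eq]
    simp at h0
    rw [h0]
    group
  rw [hA, trefoil_stair_top k p q t a hpq htq ha hcomm, hp2, htk] at hml
  have htr : 2 < ((a.1 : SpecialLinearGroup (Fin 2) ℝ) : Matrix (Fin 2) (Fin 2) ℝ).trace := by
    have hT2 : (T ^ 2)⁻¹ = rotSL (-(2 * θ)) := by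
      rw [inv_eq_iff_mul_eq_one]
      change rotSL θ ^ 2 * _ = 1
      rw [rotSL_pow, rotSL_add, ← rotSL_zero]
      congr 1
      push_cast; ring
    have ha1 : a.1 = Q * rotSL (-(2 * θ)) := by rw [← hT2]; rfl
    have h00 : a.1 0 0 = s * γ * (2 * c ^ 2 - 1) + c * γ⁻¹ * (2 * s * c) := by
      rw [ha1, sl_mul_apply]
      simp [Q, rotSL, Real.cos_two_mul, Real.sin_two_mul, ← hs, ← hc]
    have h11 : a.1 1 1 = c * γ * (2 * s * c) + s * γ⁻¹ * (2 * c ^ 2 - 1) := by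
      rw [ha1, sl_mul_apply]
      simp [Q, rotSL, Real.cos_two_mul, Real.sin_two_mul, ← hs, ← hc]
    have : ((a.1 : SpecialLinearGroup (Fin 2) ℝ) : Matrix (Fin 2) (Fin 2) ℝ).trace
        = a.1 0 0 + a.1 1 1 := Matrix.trace_fin_two _
    rw [this, h00, h11]
    have : s * γ * (2 * c ^ 2 - 1) + c * γ⁻¹ * (2 * s * c) +
        (c * γ * (2 * s * c) + s * γ⁻¹ * (2 * c ^ 2 - 1)) = 4 * c ^ 2 - 1 := by
      linear_combination (4 * c ^ 2 - 1) * hγ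
    rw [this]
    nlinarith
  have hm : m = 0 := by
    have h1 := congrArg Prod.fst hml
    simp only [Prod.fst_mul, Prod.pow_fst, Prod.fst_inv, Prod.fst_one] at h1
    have h2 : (a.1 * a.1) ^ m = (((-1 : SpecialLinearGroup (Fin 2) ℝ) ^ k * ((-1) ^ 6)⁻¹) ^ l)⁻¹ :=
      eq_inv_of_mul_eq_one_left h1
    have hN : ((-1 : SpecialLinearGroup (Fin 2) ℝ) ^ k * ((-1) ^ 6)⁻¹) ^ (2 : ℤ) = 1 := by
      rcases neg_one_pow_eq_or (SpecialLinearGroup (Fin 2) ℝ) k with h | h <;> rw [h] <;> norm_num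
    have h3 : a.1 ^ (4 * m) = 1 := by
      have h4 : a.1 ^ (4 * m) = ((a.1 * a.1) ^ m) ^ (2 : ℤ) := by
        rw [← pow_two, ← zpow_natCast, ← _root_.zpow_mul, ← _root_.zpow_mul]
        congr 1
        push_cast; ring
      rw [h4, h2, _root_.inv_zpow, ← _root_.zpow_mul, mul_comm l 2, _root_.zpow_mul, hN, _root_.one_zpow, inv_one]
    have := zpow_ne_one_of_trace a.1 htr _ h3
    omega
  refine ⟨hm, ?_⟩
  rw [hm, zpow_zero, one_mul] at hml
  have h1 := congrArg Prod.snd hml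
  simp only [Prod.snd_mul, Prod.pow_snd, Prod.snd_inv, Prod.snd_one] at h1
  have h2 : shiftPerm Real.pi ^ (((k : ℤ) - 6) * l) = 1 := by
    rw [_root_.zpow_mul, _root_.zpow_sub]
    exact h1
  rw [shiftPerm_zpow] at h2
  have h3 := shiftPerm_eq_one _ h2
  have h4 : ((((k : ℤ) - 6) * l : ℤ) : ℝ) = 0 := by
    rcases mul_eq_zero.1 h3 with h | h
    · exact h
    · exact absurd h hpi.ne'
  have h5 : ((k : ℤ) - 6) * l = 0 := by exact_mod_cast h4
  rcases mul_eq_zero.1 h5 with h | h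
  · omega
  · exact h

end Large

section Small

/-- Heisenberg group elements acting on `ℤ × ℤ`. -/
def heis (u v w : ℤ) : Equiv.Perm (ℤ × ℤ) where
  toFun z := (z.1 + u, z.2 + v * z.1 + w)
  invFun z := (z.1 - u, z.2 - v * (z.1 - u) - w)
  left_inv z := by ext <;> simp <;> ring
  right_inv z := by ext <;> simp <;> ring

theorem heis_mul (u v w u' v' w' : ℤ) :
    heis u v w * heis u' v' w' = heis (u + u') (v + v') (w + w' + v * u') := by
  ext z <;> simp [heis] <;> ring

theorem heis_one : heis 0 0 0 = 1 := by
  ext z <;> simp [heis]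

theorem heis_zpow_u (u : ℤ) (m : ℤ) : heis u 0 0 ^ m = heis (m * u) 0 0 := by
  let F : Multiplicative ℤ →* Equiv.Perm (ℤ × ℤ) :=
    { toFun := fun a => heis a.toAdd 0 0
      map_one' := heis_one
      map_mul' := fun a b => by simp [heis_mul] }
  have := map_zpow F (Multiplicative.ofAdd u) m
  rw [← ofAdd_zsmul] at this
  simpa [F, mul_comm] using this.symm

theorem heis_zpow_w (w : ℤ) (m : ℤ) : heis 0 0 w ^ m = heis 0 0 (m * w) := by
  let F : Multiplicative ℤ →* Equiv.Perm (ℤ × ℤ) :=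
    { toFun := fun a => heis 0 0 a.toAdd
      map_one' := heis_one
      map_mul' := fun a b => by simp [heis_mul] }
  have := map_zpow F (Multiplicative.ofAdd w) m
  rw [← ofAdd_zsmul] at this
  simpa [F, mul_comm] using this.symm

/-- Images of the twelve generators in the Heisenberg group. -/
def gen12 (i : ZMod (2 * 6)) : Equiv.Perm (ℤ × ℤ) :=
  heis ((![1, 0, -1, -1, 0, 1, 1, 0, -1, -1, 0, 1] : Fin 12 → ℤ) i)
    ((![0, 1, 1, 0, -1, -1, 0, 1, 1, 0, -1, -1] : Fin 12 → ℤ) i)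
    ((![0, 0, 0, 1, 1, 0, 0, 0, 0, 1, 1, 0] : Fin 12 → ℤ) i)

theorem gen12_rel (i : ZMod (2 * 6)) :
    gen12 i * gen12 (i + (((6 : ℕ) : ZMod (2 * 6)) + 2)) = gen12 (i + 1) := by
  unfold gen12
  rw [heis_mul]
  congr 1 <;> revert i <;> decide

theorem gen12_stair : ∃ w : ℤ, w ≠ 0 ∧ stairWord gen12 (2 * 6) = heis 0 0 w := by
  have h : stairWord gen12 (2 * 6) = 1 * gen12 2 * gen12 5 * gen12 8 * gen12 11 * gen12 2 *
      gen12 5 * gen12 8 * gen12 11 * gen12 2 * gen12 5 * gen12 8 * gen12 11 := rfl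
  have h2 : gen12 2 = heis (-1) 1 0 := rfl
  have h5 : gen12 5 = heis 1 (-1) 0 := rfl
  have h8 : gen12 8 = heis (-1) 1 0 := rfl
  have h11 : gen12 11 = heis 1 (-1) 0 := rfl
  rw [h, h2, h5, h8, h11, one_mul]
  simp only [heis_mul]
  exact ⟨_, by norm_num, rfl⟩

theorem case12 :
    ∃ f : Multiplicative (ℤ × ℤ) →* Gneg (2 * 6) ((2 * 6 / 2 + 2 : ℕ) : ZMod (2 * 6)) 1,
      Function.Injective f := by
  refine main_criterion 6 gen12 gen12_rel ?_
  intro p q h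
  obtain ⟨w, hw, hB⟩ := gen12_stair
  have hA : gen12 0 * gen12 ((6 : ℕ) : ZMod (2 * 6)) = heis 2 0 0 := by
    have h0 : gen12 0 = heis 1 0 0 := rfl
    have h6 : gen12 ((6 : ℕ) : ZMod (2 * 6)) = heis 1 0 0 := rfl
    rw [h0, h6, heis_mul]; rfl
  rw [hA, hB, heis_zpow_u, heis_zpow_w, heis_mul] at h
  have h1 := congrArg (fun f : Equiv.Perm (ℤ × ℤ) => f (0, 0)) h
  simp [heis, hw] at h1
  exact h1

/-- Multiplication by a primitive cube root of unity on the Eisenstein integers. -/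
def rotE : Equiv.Perm (ℤ × ℤ) where
  toFun z := (-z.2, z.1 - z.2)
  invFun z := (z.2 - z.1, -z.1)
  left_inv z := by ext <;> simp
  right_inv z := by ext <;> simp

/-- The affine map `z ↦ ω ^ h z + (a + b ω)` of the Eisenstein integers. -/
def affE (h : ℕ) (a b : ℤ) : Equiv.Perm (ℤ × ℤ) := heis 0 0 b * Equiv.addRight (a, 0) * rotE ^ h

theorem affE_zero_mul (a b : ℤ) (h : ℕ) (a' b' : ℤ) :
    affE 0 a b * affE h a' b' = affE h (a + a') (b + b') := by
  ext z <;> simp [affE, heis] <;> ring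

theorem affE_one_mul (a b : ℤ) (h : ℕ) (a' b' : ℤ) :
    affE 1 a b * affE h a' b' = affE (h + 1) (a - b') (b + a' - b') := by
  ext z <;> simp [affE, heis, rotE, pow_succ'] <;> ring

theorem affE_two_mul (a b : ℤ) (h : ℕ) (a' b' : ℤ) :
    affE 2 a b * affE h a' b' = affE (h + 2) (a + b' - a') (b - a') := by
  ext z <;> simp [affE, heis, rotE, pow_succ'] <;> ring

theorem affE_red (h : ℕ) (a b : ℤ) : affE (h + 3) a b = affE h a b := by
  ext z <;> simp [affE, heis, rotE, pow_succ'] <;> ring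

theorem affE_zpow (a b : ℤ) (m : ℤ) : affE 0 a b ^ m = affE 0 (m * a) (m * b) := by
  let F : Multiplicative (ℤ × ℤ) →* Equiv.Perm (ℤ × ℤ) :=
    { toFun := fun v => affE 0 v.toAdd.1 v.toAdd.2
      map_one' := by ext z <;> simp [affE, heis]
      map_mul' := fun a b => by simp [affE_zero_mul] }
  have := map_zpow F (Multiplicative.ofAdd (a, b)) m
  rw [← ofAdd_zsmul] at this
  simpa [F] using this.symm

/-- First affine representation of `G_8`. -/
def gen8a : Fin 8 → Equiv.Perm (ℤ × ℤ) :=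
  ![affE 1 0 1, affE 0 0 1, affE 1 0 1, affE 2 (-1) 0, affE 2 0 0, affE 0 1 0, affE 2 0 0,
    affE 1 0 0]

/-- Second affine representation of `G_8`. -/
def gen8b : Fin 8 → Equiv.Perm (ℤ × ℤ) :=
  ![affE 1 0 0, affE 1 0 1, affE 0 0 1, affE 1 0 1, affE 2 (-1) 0, affE 2 0 0, affE 0 1 0,
    affE 2 0 0]

/-- Both representations together. -/
def gen8 (i : ZMod (2 * 4)) : Equiv.Perm (ℤ × ℤ) × Equiv.Perm (ℤ × ℤ) := (gen8a i, gen8b i)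

theorem gen8a_rel (i : Fin 8) : gen8a i * gen8a (i + 6) = gen8a (i + 1) := by
  have r3 := affE_red 0
  have r4 := affE_red 1
  simp only [Nat.reduceAdd] at r3 r4
  fin_cases i <;> simp [gen8a, affE_zero_mul, affE_one_mul, affE_two_mul, r3, r4]

theorem gen8b_rel (i : Fin 8) : gen8b i * gen8b (i + 6) = gen8b (i + 1) := by
  have r3 := affE_red 0
  have r4 := affE_red 1
  simp only [Nat.reduceAdd] at r3 r4
  fin_cases i <;> simp [gen8b, affE_zero_mul, affE_one_mul, affE_two_mul, r3, r4]

theorem case8 :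
    ∃ f : Multiplicative (ℤ × ℤ) →* Gneg (2 * 4) ((2 * 4 / 2 + 2 : ℕ) : ZMod (2 * 4)) 1,
      Function.Injective f := by
  refine main_criterion 4 gen8 (fun i => Prod.ext (gen8a_rel i) (gen8b_rel i)) ?_
  intro p q h
  have r3 := affE_red 0
  have r4 := affE_red 1
  simp only [Nat.reduceAdd] at r3 r4
  have hA : gen8 0 * gen8 ((4 : ℕ) : ZMod (2 * 4)) = (affE 0 0 1, affE 0 0 (-1)) := by
    refine Prod.ext ?_ ?_
    · change gen8a 0 * gen8a 4 = _
      simp [gen8a, affE_one_mul, r3]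
    · change gen8b 0 * gen8b 4 = _
      simp [gen8b, affE_one_mul, r3]
  have hB : stairWord gen8 (2 * 4) = (affE 0 0 3, affE 0 0 3) := by
    have h : stairWord gen8 (2 * 4) = 1 * gen8 2 * gen8 5 * gen8 0 * gen8 3 * gen8 6 *
      gen8 1 * gen8 4 * gen8 7 := rfl
    rw [h, one_mul]
    refine Prod.ext ?_ ?_
    · change gen8a 2 * gen8a 5 * gen8a 0 * gen8a 3 * gen8a 6 * gen8a 1 * gen8a 4 * gen8a 7 = _
      simp [gen8a, affE_zero_mul, affE_one_mul, affE_two_mul, r3, r4]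
    · change gen8b 2 * gen8b 5 * gen8b 0 * gen8b 3 * gen8b 6 * gen8b 1 * gen8b 4 * gen8b 7 = _
      simp [gen8b, affE_zero_mul, affE_one_mul, affE_two_mul, r3, r4]
  rw [hA, hB] at h
  have h1 := congrArg Prod.fst h
  have h2 := congrArg Prod.snd h
  simp only [Prod.fst_mul, Prod.pow_fst, Prod.snd_mul, Prod.pow_snd, affE_zpow, affE_zero_mul,
    Prod.fst_one, Prod.snd_one] at h1 h2
  have h3 := congrArg (fun f : Equiv.Perm (ℤ × ℤ) => (f (0, 0)).2) h1
  have h4 := congrArg (fun f : Equiv.Perm (ℤ × ℤ) => (f (0, 0)).2) h2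
  simp [affE, heis] at h3 h4
  omega

end Small

theorem stmt19 (n : ℕ) (hn : 8 ≤ n) (heven : 2 ∣ n) (hne : n ≠ 10) :
    ∃ f : Multiplicative (ℤ × ℤ) →* Gneg n ((n / 2 + 2 : ℕ) : ZMod n) 1,
      Function.Injective f := by
  obtain ⟨k, rfl⟩ := heven
  rcases Nat.lt_or_ge k 7 with hk | hk
  · have : k = 4 ∨ k = 6 := by omega
    rcases this with rfl | rfl
    · exact case8
    · exact case12
  · exact large_case k hk
end
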